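/- Let 𝔽 be a countable field with the discrete topology, r ≥ 1 an integer, and K_r the Pontryagin dual of the discrete abelian group 𝔽^r, a compact metrizable abelian group. Let Aut_𝔽(K_r) denote the group of automorphisms of K_r dual to 𝔽-linear automorphisms of 𝔽^r. Then: (1) the center of Aut_𝔽(K_r), i.e. the group of continuous automorphisms of K_r commuting with every element of Aut_𝔽(K_r), has DCC on K_r; (2) if Γ is a finitely generated abelian subgroup of Aut_𝔽(K_r) which is ergodic on K_r, then some α ∈ Γ is ergodic on K_r. -/

import Mathlib

open MeasureTheory Topology Set

set_option linter.unusedVariables false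

namespace ErgZd

variable {K : Type*}

/-- The group of bi-continuous automorphisms of a topological group,
as a subgroup of `MulAut K`. -/
def ContAut (K : Type*) [Group K] [TopologicalSpace K] : Subgroup (MulAut K) where
  carrier := {α | Continuous α ∧ Continuous α.symm}
  one_mem' := ⟨continuous_id, continuous_id⟩
  mul_mem' := fun {a b} ha hb => ⟨ha.1.comp hb.1, hb.2.comp ha.2⟩
  inv_mem' := fun {a} ha => ⟨ha.2, ha.1⟩

section Defs

variable [Group K] [TopologicalSpace K]

lemma ContAut.continuous (α : ↥(ContAut K)) : Continuous ⇑(α : MulAut K) := α.2.1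

lemma ContAut.continuous_symm (α : ↥(ContAut K)) :
    Continuous ⇑(α : MulAut K).symm := α.2.2

/-- Ergodicity of the action of a set `S` of automorphisms with respect to `μ`:
every invariant Borel set is null or conull. -/
def ErgSet [MeasurableSpace K] (μ : Measure K) (S : Set ↥(ContAut K)) : Prop :=
  ∀ A : Set K, MeasurableSet A → (∀ α ∈ S, (α : MulAut K) '' A = A) → μ A = 0 ∨ μ A = 1

/-- Ergodicity of a single automorphism: ergodicity of the group of its integer powers. -/
def ErgAut [MeasurableSpace K] (μ : Measure K) (α : ↥(ContAut K)) : Prop :=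
  ErgSet μ (Set.range fun n : ℤ => α ^ n)

/-- Distality of the action of a set of automorphisms: for `x ≠ 1`, the identity is
not in the closure of the orbit of `x`. -/
def DistalSet (S : Set ↥(ContAut K)) : Prop :=
  ∀ x : K, x ≠ 1 → (1 : K) ∉ closure ((fun α : ↥(ContAut K) => (α : MulAut K) x) '' S)

/-- Distality of a single automorphism. -/
def DistalAut (α : ↥(ContAut K)) : Prop := DistalSet (Set.range fun n : ℤ => α ^ n)

/-- The descending chain condition for an action: every decreasing
sequence of closed invariant subgroups is eventually constant. -/
def HasDCC (S : Set ↥(ContAut K)) : Prop :=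
  ∀ C : ℕ → Subgroup K, (∀ n, IsClosed (C n : Set K)) → (∀ n, C (n + 1) ≤ C n) →
    (∀ n, ∀ α ∈ S, ∀ x, x ∈ C n ↔ (α : MulAut K) x ∈ C n) → ∃ N, ∀ n, N ≤ n → C n = C N

/-- Restriction of an automorphism to an invariant subgroup. -/
def restrictAut (H : Subgroup K) (α : ↥(ContAut K))
    (h : ∀ x, x ∈ H ↔ (α : MulAut K) x ∈ H) : ↥(ContAut ↥H) := by
  refine ⟨⟨⟨fun x => ⟨(α : MulAut K) x, (h x).mp x.2⟩,
      fun x => ⟨(α : MulAut K).symm x, (h _).mpr (by simpa using x.2)⟩, ?_, ?_⟩, ?_⟩, ?_, ?_⟩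
  · intro x; ext; simp
  · intro x; ext; simp
  · intro x y; ext; simp
  · exact Continuous.subtype_mk ((ContAut.continuous α).comp continuous_subtype_val) _
  · exact Continuous.subtype_mk ((ContAut.continuous_symm α).comp continuous_subtype_val) _

@[simp] lemma restrictAut_coe (H : Subgroup K) (α : ↥(ContAut K))
    (h : ∀ x, x ∈ H ↔ (α : MulAut K) x ∈ H) (x : ↥H) :
    ((((restrictAut H α h) : MulAut ↥H) x : ↥H) : K) = (α : MulAut K) (x : K) := rfl

/-- The automorphism induced on the quotient by an invariant closed normal subgroup. -/
def quotAut (N : Subgroup K) [N.Normal] (α : ↥(ContAut K))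
    (h : ∀ x, x ∈ N ↔ (α : MulAut K) x ∈ N) : ↥(ContAut (K ⧸ N)) := by
  have hmap : N.map ((α : MulAut K) : K ≃* K) = N := by
    ext y
    constructor
    · rintro ⟨x, hx, rfl⟩; exact (h x).mp hx
    · intro hy
      exact ⟨(α : MulAut K).symm y, (h _).mpr (by simpa using hy), by simp⟩
  refine ⟨QuotientGroup.congr N N ((α : MulAut K) : K ≃* K) hmap, ?_, ?_⟩
  · apply (QuotientGroup.isQuotientMap_mk N).continuous_iff.mpr
    have : ⇑(QuotientGroup.congr N N ((α : MulAut K) : K ≃* K) hmap) ∘ (QuotientGroup.mk : K → K ⧸ N)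
        = (QuotientGroup.mk : K → K ⧸ N) ∘ ⇑(α : MulAut K) := by
      funext x
      exact QuotientGroup.congr_mk N N _ hmap x
    rw [this]
    exact QuotientGroup.continuous_mk.comp (ContAut.continuous α)
  · apply (QuotientGroup.isQuotientMap_mk N).continuous_iff.mpr
    have : ⇑(QuotientGroup.congr N N ((α : MulAut K) : K ≃* K) hmap).symm ∘ (QuotientGroup.mk : K → K ⧸ N)
        = (QuotientGroup.mk : K → K ⧸ N) ∘ ⇑((α : MulAut K) : K ≃* K).symm := by
      funext x
      rfl
    rw [this]
    exact QuotientGroup.continuous_mk.comp (ContAut.continuous_symm α)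

end Defs

section Dual

variable (A : Type*) [CommGroup A] [TopologicalSpace A]

/-- A bi-continuous automorphism of `A`, as a continuous monoid homomorphism. -/
def ContAut.toCMH (e : ↥(ContAut A)) : ContinuousMonoidHom A A :=
  ⟨(((e : MulAut A) : A ≃* A) : A →* A), ContAut.continuous e⟩

/-- The dual automorphism `χ ↦ χ ∘ e⁻¹` of the Pontryagin dual induced by a
bi-continuous automorphism `e` of `A`. -/
noncomputable def dualAut (e : ↥(ContAut A)) : ↥(ContAut (PontryaginDual A)) := by
  refine ⟨⟨⟨⇑(PontryaginDual.map (ContAut.toCMH A e⁻¹)),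
      ⇑(PontryaginDual.map (ContAut.toCMH A e)), ?_, ?_⟩, ?_⟩, ?_, ?_⟩
  · intro χ
    refine DFunLike.ext _ _ fun y => ?_
    exact congrArg χ (MulEquiv.symm_apply_apply ((e : MulAut A) : A ≃* A) y)
  · intro χ
    refine DFunLike.ext _ _ fun y => ?_
    exact congrArg χ (MulEquiv.apply_symm_apply ((e : MulAut A) : A ≃* A) y)
  · intro χ ρ
    exact map_mul (PontryaginDual.map (ContAut.toCMH A e⁻¹)) χ ρ
  · exact (PontryaginDual.map (ContAut.toCMH A e⁻¹)).continuous_toFun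
  · exact (PontryaginDual.map (ContAut.toCMH A e)).continuous_toFun

end Dual

/-- The automorphism of the (multiplicatively written) discrete group `𝔽^r` given by an
`𝔽`-linear automorphism. -/
def linearContAut (𝔽 : Type*) [Field 𝔽] [TopologicalSpace 𝔽] [DiscreteTopology 𝔽] (r : ℕ)
    (e : (Fin r → 𝔽) ≃ₗ[𝔽] (Fin r → 𝔽)) : ↥(ContAut (Multiplicative (Fin r → 𝔽))) :=
  ⟨AddEquiv.toMultiplicative e.toAddEquiv,
    continuous_of_discreteTopology, continuous_of_discreteTopology⟩

section Analysis

variable {A : Type*} [CommGroup A] [TopologicalSpace A]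

lemma continuous_ev (a : A) : Continuous (fun χ : PontryaginDual A => χ a) := by
  have h : Continuous (fun χ : A →ₜ* Circle => χ.toContinuousMap a) :=
    (continuous_eval_const a).comp
      (ContinuousMonoidHom.isInducing_toContinuousMap A Circle).continuous
  exact h

lemma continuous_evC (a : A) : Continuous (fun χ : PontryaginDual A => (χ a : ℂ)) :=
  continuous_subtype_val.comp (continuous_ev a)

lemma dual_mul_apply (χ ψ : PontryaginDual A) (a : A) : (χ * ψ) a = χ a * ψ a := rfl

lemma dual_inv_apply (χ : PontryaginDual A) (a : A) : (χ⁻¹) a = (χ a)⁻¹ := rfl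

variable [DiscreteTopology A]

lemma dual_secondCountable [Countable A] : SecondCountableTopology (PontryaginDual A) := by
  have : SecondCountableTopology C(A, Circle) := inferInstance
  have : IsInducing (fun χ : A →ₜ* Circle => χ.toContinuousMap) :=
      (ContinuousMonoidHom.isInducing_toContinuousMap A Circle)
  exact this.secondCountableTopology

/-- evaluation at `a` as a bounded continuous function -/
noncomputable def ev (a : A) : BoundedContinuousFunction (PontryaginDual A) ℂ :=
  BoundedContinuousFunction.mkOfCompact ⟨fun χ => (χ a : ℂ), continuous_evC a⟩

lemma ev_apply (a : A) (χ : PontryaginDual A) : ev a χ = (χ a : ℂ) := rfl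

lemma ev_mul (a b : A) : ev (a * b) = ev a * ev b := by
  ext χ
  simp [ev_apply]

lemma ev_one : ev (1 : A) = 1 := by
  ext χ
  simp [ev_apply]

lemma star_ev (a : A) : star (ev a) = ev a⁻¹ := by
  ext χ
  change (starRingEnd ℂ) (χ a : ℂ) = (χ a⁻¹ : ℂ)
  rw [map_inv, Circle.coe_inv_eq_conj]

/-- the star subalgebra generated by evaluations -/
noncomputable def evAlg (A : Type*) [CommGroup A] [TopologicalSpace A] [DiscreteTopology A] :
    StarSubalgebra ℂ (BoundedContinuousFunction (PontryaginDual A) ℂ) where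
  toSubalgebra := Algebra.adjoin ℂ (Set.range ev)
  star_mem' := by
    change Algebra.adjoin ℂ (Set.range ev) ≤ star (Algebra.adjoin ℂ (Set.range ev))
    refine Algebra.adjoin_le ?_
    rintro - ⟨n, rfl⟩
    refine Algebra.subset_adjoin ⟨n⁻¹, ?_⟩
    rw [← star_ev]

lemma evAlg_span (g : BoundedContinuousFunction (PontryaginDual A) ℂ) (hg : g ∈ evAlg A) :
    g ∈ Submodule.span ℂ (Set.range (ev (A := A))) := by
  have h : g ∈ Subalgebra.toSubmodule (Algebra.adjoin ℂ (Set.range (ev (A := A)))) := hg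
  rw [Algebra.adjoin_eq_span_of_subset] at h
  · exact h
  · refine Set.Subset.trans ?_ Submodule.subset_span
    intro x hx
    refine Submonoid.closure_induction (fun _ => id) ⟨1, ev_one⟩ ?_ hx
    rintro _ _ _ _ ⟨m, rfl⟩ ⟨n, rfl⟩
    exact ⟨m * n, ev_mul m n⟩

lemma measure_ext [Countable A] [MeasurableSpace (PontryaginDual A)]
    [BorelSpace (PontryaginDual A)] (P P' : Measure (PontryaginDual A))
    [IsFiniteMeasure P] [IsFiniteMeasure P']
    (h : ∀ a : A, ∫ χ, (χ a : ℂ) ∂P = ∫ χ, (χ a : ℂ) ∂P') : P = P' := by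
  have : SecondCountableTopology (PontryaginDual A) := dual_secondCountable
  let _ : MetricSpace (PontryaginDual A) := TopologicalSpace.metrizableSpaceMetric _
  refine ext_of_forall_mem_subalgebra_integral_eq_of_pseudoEMetric_complete_countable
    (𝕜 := ℂ) (A := evAlg A) ?_ ?_
  · intro χ ψ hne
    obtain ⟨a, ha⟩ : ∃ a, χ a ≠ ψ a := by
      by_contra! hh
      exact hne (PontryaginDual.ext hh)
    refine ⟨ev a, ⟨(ev a).toContinuousMap, ⟨ev a, ?_, rfl⟩, rfl⟩, ?_⟩
    · exact Algebra.subset_adjoin ⟨a, rfl⟩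
    · intro hh
      exact ha (Circle.ext hh)
  · intro g hg
    have := evAlg_span g hg
    clear hg
    induction this using Submodule.span_induction with
    | mem x hx => obtain ⟨a, rfl⟩ := hx; exact h a
    | zero => simp
    | add x y _ _ hx hy =>
      simp only [BoundedContinuousFunction.coe_add, Pi.add_apply]
      rw [integral_add (x.integrable P) (y.integrable P),
        integral_add (x.integrable P') (y.integrable P'), hx, hy]
    | smul c x _ hx =>
      simp only [BoundedContinuousFunction.coe_smul, integral_smul, hx]

lemma exists_char_ne (a : A) (ha : a ≠ 1) : ∃ χ : PontryaginDual A, χ a ≠ 1 := by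
  have ha' : Additive.ofMul a ≠ 0 := ha
  obtain ⟨c, hc⟩ := CharacterModule.exists_character_apply_ne_zero_of_ne_zero ha'
  let φ : AddCircle (1 : ℚ) →+ AddCircle (1 : ℝ) :=
    QuotientAddGroup.map _ _ (Rat.castHom ℝ).toAddMonoidHom (by
      rw [AddSubgroup.zmultiples_le]
      refine ⟨1, ?_⟩
      simp)
  let χ : A →* Circle :=
    { toFun := fun x => AddCircle.toCircle (φ (c (Additive.ofMul x)))
      map_one' := by
        rw [ofMul_one, map_zero, map_zero, AddCircle.toCircle_zero]
      map_mul' := fun x y => by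
        rw [ofMul_mul, map_add, map_add, AddCircle.toCircle_add] }
  refine ⟨(⟨χ, continuous_of_discreteTopology⟩ : A →ₜ* Circle), ?_⟩
  change AddCircle.toCircle (φ (c (Additive.ofMul a))) ≠ 1
  intro h
  rw [← AddCircle.toCircle_zero (T := 1)] at h
  have h2 := AddCircle.injective_toCircle one_ne_zero h
  obtain ⟨q, hq⟩ := QuotientAddGroup.mk_surjective (c (Additive.ofMul a))
  rw [← hq] at h2 hc
  have h3 : ((q : ℝ) : AddCircle (1 : ℝ)) = 0 := h2
  rw [AddCircle.coe_eq_zero_iff] at h3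
  obtain ⟨n, hn⟩ := h3
  apply hc
  refine (AddCircle.coe_eq_zero_iff (1 : ℚ)).mpr ⟨n, ?_⟩
  have : (n : ℝ) = q := by simpa using hn
  simp only [zsmul_eq_mul, mul_one]
  exact_mod_cast this

lemma integral_ev_zero [MeasurableSpace (PontryaginDual A)]
    [BorelSpace (PontryaginDual A)] (μ : Measure (PontryaginDual A)) [μ.IsMulLeftInvariant]
    (a : A) (ha : a ≠ 1) : ∫ χ, (χ a : ℂ) ∂μ = 0 := by
  obtain ⟨ψ, hψ⟩ := exists_char_ne a ha
  have h := integral_mul_left_eq_self (μ := μ) (fun χ : PontryaginDual A => (χ a : ℂ)) ψ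
  simp only [dual_mul_apply, Circle.coe_mul] at h
  rw [integral_const_mul] at h
  have : ((ψ a : ℂ) - 1) * ∫ χ, (χ a : ℂ) ∂μ = 0 := by rw [sub_mul, h]; simp
  rcases mul_eq_zero.mp this with h1 | h1
  · exact absurd (Circle.ext (by simpa [sub_eq_zero] using h1)) hψ
  · exact h1

lemma mem_of_annihilator [Countable A] (C : Subgroup (PontryaginDual A))
    (hC : IsClosed (C : Set (PontryaginDual A)))
    (χ₀ : PontryaginDual A) (h0 : ∀ a : A, (∀ χ ∈ C, χ a = 1) → χ₀ a = 1) : χ₀ ∈ C := by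
  by_contra hn
  borelize (PontryaginDual A)
  have : CompactSpace C := isCompact_iff_compactSpace.mp hC.isCompact
  have : SecondCountableTopology (PontryaginDual A) := dual_secondCountable
  let ν₀ : Measure C := Measure.haarMeasure ⊤
  have : IsProbabilityMeasure ν₀ := ⟨by
    have := Measure.haarMeasure_self (K₀ := (⊤ : TopologicalSpace.PositiveCompacts C))
    simpa using this⟩
  have hmv : Measurable (Subtype.val : C → PontryaginDual A) := measurable_subtype_coe
  let ν : Measure (PontryaginDual A) := ν₀.map Subtype.val
  have : IsProbabilityMeasure ν := Measure.isProbabilityMeasure_map hmv.aemeasurable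
  let ν' : Measure (PontryaginDual A) := ν.map (χ₀ * ·)
  have hmm : Measurable (fun χ : PontryaginDual A => χ₀ * χ) := (continuous_const_mul χ₀).measurable
  have : IsProbabilityMeasure ν' := Measure.isProbabilityMeasure_map hmm.aemeasurable
  have hνint : ∀ a : A, ∫ χ, (χ a : ℂ) ∂ν = ∫ c : C, ((c : PontryaginDual A) a : ℂ) ∂ν₀ := fun a =>
    integral_map hmv.aemeasurable (continuous_evC a).aestronglyMeasurable
  have hν'int : ∀ a : A, ∫ χ, (χ a : ℂ) ∂ν' = (χ₀ a : ℂ) * ∫ χ, (χ a : ℂ) ∂ν := fun a => by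
    have h := integral_map (μ := ν) hmm.aemeasurable (f := fun χ : PontryaginDual A => (χ a : ℂ))
      (continuous_evC a).aestronglyMeasurable
    rw [show ∫ χ, (χ a : ℂ) ∂ν' = _ from h]
    simp only [dual_mul_apply, Circle.coe_mul]
    rw [integral_const_mul]
  have heq : ν' = ν := by
    refine measure_ext _ _ fun a => ?_
    rw [hν'int]
    by_cases ha : ∀ χ ∈ C, χ a = 1
    · simp [h0 a ha]
    · push Not at ha
      obtain ⟨ψ, hψC, hψ⟩ := ha
      have h := integral_mul_left_eq_self (μ := ν₀)
        (fun χ : C => ((χ : PontryaginDual A) a : ℂ)) ⟨ψ, hψC⟩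
      simp only [Subgroup.coe_mul, dual_mul_apply, Circle.coe_mul] at h
      rw [integral_const_mul, ← hνint] at h
      have : ((ψ a : ℂ) - 1) * ∫ χ, (χ a : ℂ) ∂ν = 0 := by rw [sub_mul, h]; simp
      rcases mul_eq_zero.mp this with h1 | h1
      · exact absurd (Circle.ext (by simpa [sub_eq_zero] using h1)) hψ
      · simp [h1]
  have h1 : ν C = 1 := by
    rw [Measure.map_apply hmv hC.measurableSet]
    convert measure_univ (μ := ν₀)
    ext c
    simp
  have h2 : ν' C = 0 := by
    rw [Measure.map_apply hmm hC.measurableSet, Measure.map_apply hmv (hmm hC.measurableSet)]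
    convert measure_empty (μ := ν₀)
    ext c
    simp only [mem_preimage, SetLike.mem_coe, mem_empty_iff_false, iff_false]
    intro hc
    exact hn ((Subgroup.mul_mem_cancel_right C c.2).mp hc)
  rw [heq, h1] at h2
  exact one_ne_zero h2

end Analysis
section Erg

variable {A : Type*} [CommGroup A] [TopologicalSpace A]

lemma dualAut_apply (e : ↥(ContAut A)) (χ : PontryaginDual A) (a : A) :
    ((dualAut A e : ↥(ContAut (PontryaginDual A))) : MulAut (PontryaginDual A)) χ a
      = χ (((e⁻¹ : ↥(ContAut A)) : MulAut A) a) := rfl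

/-- dualization as a homomorphism -/
noncomputable def dualHom (A : Type*) [CommGroup A] [TopologicalSpace A] :
    ↥(ContAut A) →* ↥(ContAut (PontryaginDual A)) :=
  MonoidHom.mk' (dualAut A) (fun e f => by
    apply Subtype.ext
    apply MulEquiv.ext
    intro χ
    apply PontryaginDual.ext
    intro a
    rw [dualAut_apply, mul_inv_rev]
    rfl)

lemma dualHom_apply (e : ↥(ContAut A)) : dualHom A e = dualAut A e := rfl

variable [DiscreteTopology A] [MeasurableSpace (PontryaginDual A)]
    [BorelSpace (PontryaginDual A)] (μ : Measure (PontryaginDual A))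
    [μ.IsHaarMeasure] [IsProbabilityMeasure μ]

lemma integrable_evC (P : Measure (PontryaginDual A)) [IsFiniteMeasure P] (a : A) :
    Integrable (fun χ : PontryaginDual A => (χ a : ℂ)) P :=
  (ev a).integrable P

lemma orbit_infinite (H : Subgroup ↥(ContAut A)) (hE : ErgSet μ (dualAut A '' (H : Set _)))
    (v : A) (hv : v ≠ 1) : {w : A | ∃ h ∈ H, (h : MulAut A) v = w}.Infinite := by
  intro hfin
  set O := hfin.toFinset with hO
  have memO : ∀ w, w ∈ O ↔ ∃ h ∈ H, (h : MulAut A) v = w := fun w => by simp [hO]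
  let F : PontryaginDual A → ℂ := fun χ => ∑ w ∈ O, (χ w : ℂ)
  have hFc : Continuous F := continuous_finsetSum _ fun w _ => continuous_evC w
  have hFinv : ∀ h ∈ H, ∀ χ : PontryaginDual A, F ((dualAut A h : MulAut (PontryaginDual A)) χ) = F χ := by
    intro h hh χ
    simp only [F, dualAut_apply]
    refine Finset.sum_bij' (fun w _ => ((h⁻¹ : ↥(ContAut A)) : MulAut A) w)
      (fun w _ => (h : MulAut A) w) ?_ ?_ ?_ ?_ ?_
    · intro w hw
      obtain ⟨k, hk, rfl⟩ := (memO w).mp hw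
      exact (memO _).mpr ⟨h⁻¹ * k, H.mul_mem (H.inv_mem hh) hk, rfl⟩
    · intro w hw
      obtain ⟨k, hk, rfl⟩ := (memO w).mp hw
      exact (memO _).mpr ⟨h * k, H.mul_mem hh hk, rfl⟩
    · intro w hw
      exact MulEquiv.apply_symm_apply (h : MulAut A) w
    · intro w hw
      exact MulEquiv.symm_apply_apply (h : MulAut A) w
    · intro w hw
      rfl
  have hvO : v ∈ O := (memO v).mpr ⟨1, H.one_mem, rfl⟩
  have hcard : (0 : ℝ) < O.card := by exact_mod_cast Finset.card_pos.mpr ⟨v, hvO⟩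
  have hFi : ∫ χ, F χ ∂μ = 0 := by
    simp only [F]
    rw [integral_finsetSum _ fun w _ => integrable_evC μ w]
    refine Finset.sum_eq_zero fun w hw => integral_ev_zero μ w ?_
    rintro rfl
    obtain ⟨h, hh, h1⟩ := (memO 1).mp hw
    exact hv ((map_eq_one_iff (h : MulAut A) (MulEquiv.injective _)).mp h1)
  have hFint : Integrable F μ := integrable_finsetSum _ fun w _ => integrable_evC μ w
  let S : Set (PontryaginDual A) := {χ | (O.card : ℝ) / 2 < (F χ).re}
  have hSo : IsOpen S := isOpen_lt continuous_const (Complex.continuous_re.comp hFc)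
  have hS1 : (1 : PontryaginDual A) ∈ S := by
    have h1 : F 1 = O.card := by
      simp only [F, PontryaginDual.one_apply, Circle.coe_one]
      simp
    change (O.card : ℝ) / 2 < (F 1).re
    rw [h1, Complex.natCast_re]
    linarith
  have hpos : μ S ≠ 0 := (hSo.measure_pos μ ⟨1, hS1⟩).ne'
  have hSinv : ∀ α ∈ dualAut A '' (H : Set _), (α : MulAut (PontryaginDual A)) '' S = S := by
    rintro _ ⟨h, hh, rfl⟩
    ext χ
    constructor
    · rintro ⟨ψ, hψ, rfl⟩
      simpa only [S, mem_ofPred_eq, hFinv h hh] using hψ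
    · intro hχ
      refine ⟨(dualAut A h : MulAut (PontryaginDual A)).symm χ, ?_, MulEquiv.apply_symm_apply _ χ⟩
      have := hFinv h hh ((dualAut A h : MulAut (PontryaginDual A)).symm χ)
      rw [MulEquiv.apply_symm_apply] at this
      simpa only [S, mem_ofPred_eq, ← this] using hχ
  rcases hE S hSo.measurableSet hSinv with h0 | h1
  · exact hpos h0
  · have hae : ∀ᵐ χ ∂μ, (O.card : ℝ) / 2 ≤ (F χ).re := by
      have : ∀ᵐ χ ∂μ, χ ∈ S := (prob_compl_eq_zero_iff hSo.measurableSet).mpr h1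
      filter_upwards [this] with χ hχ using le_of_lt hχ
    have h2 := integral_mono_ae (integrable_const _) hFint.re hae
    have h3 : ∫ χ, (F χ).re ∂μ = 0 := by
      have := integral_re (𝕜 := ℂ) hFint
      simp only [RCLike.re_eq_complex_re] at this
      rw [this, hFi]; rfl
    have h4 : (O.card : ℝ) / 2 ≤ ∫ χ, (F χ).re ∂μ := by simpa using h2
    rw [h3] at h4
    linarith

lemma integral_normSq (T : Finset A) :
    ∫ χ : PontryaginDual A, ‖∑ w ∈ T, (χ w : ℂ)‖ ^ 2 ∂μ = T.card := by
  have key : ∫ χ : PontryaginDual A, ((‖∑ w ∈ T, (χ w : ℂ)‖ ^ 2 : ℝ) : ℂ) ∂μ = (T.card : ℂ) := by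
    have h1 : ∀ χ : PontryaginDual A, ((‖∑ w ∈ T, (χ w : ℂ)‖ ^ 2 : ℝ) : ℂ)
        = ∑ w ∈ T, ∑ u ∈ T, (χ (w * u⁻¹) : ℂ) := by
      intro χ
      push_cast
      rw [← Complex.mul_conj', map_sum, Finset.sum_mul_sum]
      simp only [map_mul, map_inv, Circle.coe_mul, Circle.coe_inv_eq_conj]
    simp only [h1]
    rw [integral_finsetSum _ fun w _ => integrable_finsetSum _ fun u _ => integrable_evC μ _]
    have h2 : ∀ w ∈ T, ∫ χ : PontryaginDual A, ∑ u ∈ T, (χ (w * u⁻¹) : ℂ) ∂μ = 1 := by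
      intro w hw
      rw [integral_finsetSum _ fun u _ => integrable_evC μ _, Finset.sum_eq_single w]
      · simp
      · intro u _ hu
        apply integral_ev_zero
        rw [Ne, mul_inv_eq_one]
        exact fun h => hu h.symm
      · exact fun h => absurd hw h
    rw [Finset.sum_congr rfl h2]
    simp
  rw [integral_complex_ofReal] at key
  exact_mod_cast key

lemma coeff_bound (S : Set (PontryaginDual A)) (c : ℂ)
    (T : Finset A) (hT : ∀ w ∈ T, ∫ χ in S, (χ w : ℂ) ∂μ = c) : ‖c‖ ^ 2 * T.card ≤ 1 := by
  let F : PontryaginDual A → ℂ := fun χ => ∑ w ∈ T, (χ w : ℂ)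
  have hFc : Continuous F := continuous_finsetSum _ fun w _ => continuous_evC w
  have hFint : Integrable F μ := integrable_finsetSum _ fun w _ => integrable_evC μ w
  have h1 : ∫ χ in S, F χ ∂μ = T.card * c := by
    simp only [F]
    rw [integral_finsetSum _ fun w _ => (integrable_evC μ w).restrict, Finset.sum_congr rfl hT]
    simp
  have h2 : T.card * ‖c‖ ≤ ∫ χ, ‖F χ‖ ∂μ := by
    calc T.card * ‖c‖ = ‖∫ χ in S, F χ ∂μ‖ := by rw [h1]; simp
      _ ≤ ∫ χ in S, ‖F χ‖ ∂μ := norm_integral_le_integral_norm _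
      _ ≤ ∫ χ, ‖F χ‖ ∂μ :=
        setIntegral_le_integral hFint.norm (Filter.Eventually.of_forall fun _ => norm_nonneg _)
  set t : ℝ := T.card * ‖c‖ with ht
  have ht0 : 0 ≤ t := by positivity
  have hsq : Integrable (fun χ => ‖F χ‖ ^ 2) μ := by
    have hc : Continuous fun χ => ‖F χ‖ ^ 2 := by fun_prop
    exact (BoundedContinuousFunction.mkOfCompact ⟨_, hc⟩).integrable μ
  have h3 : 2 * t * ∫ χ, ‖F χ‖ ∂μ ≤ T.card + t ^ 2 := by
    have := integral_mono (μ := μ) (hFint.norm.const_mul (2 * t)) (hsq.add (integrable_const (t ^ 2)))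
      (fun χ => by
        simp only [Pi.add_apply]
        nlinarith [sq_nonneg (‖F χ‖ - t)])
    rw [integral_const_mul] at this
    simp only [Pi.add_apply] at this
    rw [integral_add hsq (integrable_const _), integral_normSq] at this
    simpa using this
  have h4 : t ^ 2 ≤ T.card := by nlinarith
  rcases Nat.eq_zero_or_pos T.card with h0 | h0
  · simp [h0]
  · have hN : (0 : ℝ) < T.card := by exact_mod_cast h0
    have : (T.card : ℝ) * (‖c‖ ^ 2 * T.card) ≤ T.card * 1 := by
      rw [ht] at h4; nlinarith
    exact le_of_mul_le_mul_left this hN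

lemma ergAut_of_infinite [Countable A] (e : ↥(ContAut A))
    (he : ∀ v : A, v ≠ 1 → (Set.range fun n : ℤ => ((e ^ n : ↥(ContAut A)) : MulAut A) v).Infinite) :
    ErgAut μ (dualAut A e) := by
  intro S hS hinv
  have hc : ∀ (a : A) (n : ℤ), ∫ χ in S, (χ (((e ^ n : ↥(ContAut A)) : MulAut A) a) : ℂ) ∂μ
      = ∫ χ in S, (χ a : ℂ) ∂μ := by
    intro a n
    set α : ↥(ContAut (PontryaginDual A)) := dualAut A (e ^ (-n)) with hα
    have hαe : dualAut A e ^ (-n) = α := (map_zpow (dualHom A) e (-n)).symm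
    have hαS : (α : MulAut (PontryaginDual A)) ⁻¹' S = S := by
      have := hinv α ⟨-n, hαe⟩
      conv_lhs => rw [← this]
      exact Set.preimage_image_eq _ (MulEquiv.injective _)
    have hmp : MeasurePreserving (α : MulAut (PontryaginDual A)) μ μ :=
      MonoidHom.measurePreserving
        (f := MulEquiv.toMonoidHom (α : MulAut (PontryaginDual A)))
        α.2.1 (MulEquiv.surjective (α : MulAut (PontryaginDual A))) rfl
    have hemb : MeasurableEmbedding (α : MulAut (PontryaginDual A)) :=
      (Homeomorph.mk (α : MulAut (PontryaginDual A)).toEquiv α.2.1 α.2.2).measurableEmbedding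
    have := hmp.setIntegral_preimage_emb hemb (fun χ : PontryaginDual A => (χ a : ℂ)) S
    rw [hαS] at this
    rw [← this]
    congr 1
    ext χ
    rw [hα, dualAut_apply, ← zpow_neg, neg_neg]
  have hz : ∀ a : A, a ≠ 1 → ∫ χ in S, (χ a : ℂ) ∂μ = 0 := by
    intro a ha
    by_contra hne
    set c := ∫ χ in S, (χ a : ℂ) ∂μ with hcdef
    have hcp : 0 < ‖c‖ ^ 2 := by positivity
    obtain ⟨N, hN⟩ := exists_nat_gt (1 / ‖c‖ ^ 2)
    obtain ⟨T, hT, hTc⟩ := (he a ha).exists_subset_card_eq N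
    have := coeff_bound μ S c T (fun w hw => by
      obtain ⟨n, rfl⟩ := hT hw
      exact hc a n)
    rw [hTc] at this
    rw [div_lt_iff₀ hcp] at hN
    linarith
  have heq : μ.restrict S = μ S • μ := by
    have : IsFiniteMeasure (μ S • μ) := Measure.smul_finite μ (measure_ne_top μ S)
    refine measure_ext _ _ fun a => ?_
    rw [integral_smul_measure]
    by_cases ha : a = 1
    · subst ha
      simp [Measure.real]
    · rw [hz a ha, integral_ev_zero μ a ha, smul_zero]
  have h1 : μ.restrict S Sᶜ = (μ S • μ) Sᶜ := by rw [heq]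
  rw [Measure.restrict_apply hS.compl] at h1
  simp only [compl_inter_self, measure_empty, Measure.smul_apply, smul_eq_mul] at h1
  rcases mul_eq_zero.mp h1.symm with h | h
  · exact Or.inl h
  · exact Or.inr ((prob_compl_eq_zero_iff hS).mp h)

end Erg
section Alg

open scoped IsMulCommutative Pointwise

lemma exists_good {F V G : Type*} [Field F] [AddCommGroup V] [Module F V] [FiniteDimensional F V]
    [CommGroup G] [Group.FG G] (ρ : G →* (V ≃ₗ[F] V))
    (hinf : ∀ v : V, v ≠ 0 → (Set.range fun g => ρ g v).Infinite) :
    ∃ γ : G, ∀ v : V, v ≠ 0 → ∀ n : ℕ, 0 < n → ρ (γ ^ n) v ≠ v := by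
  let s : Set (Module.End F V) := Set.range fun g => (ρ g : V →ₗ[F] V)
  have hcomm : IsMulCommutative (Algebra.adjoin F s) := by
    apply Algebra.isMulCommutative_adjoin
    rintro _ ⟨g, rfl⟩ _ ⟨h, rfl⟩
    have : ρ g * ρ h = ρ h * ρ g := by rw [← map_mul, mul_comm, map_mul]
    ext v
    exact LinearEquiv.congr_fun this v
  let R := Algebra.adjoin F s
  have : IsArtinianRing R := IsArtinianRing.of_finite F R
  have : Module.Finite R V := Module.Finite.of_restrictScalars_finite F R V
  let τ : G →* R :=
    { toFun := fun g => ⟨(ρ g : V →ₗ[F] V), Algebra.subset_adjoin ⟨g, rfl⟩⟩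
      map_one' := by
        apply Subtype.ext
        ext v
        simp
      map_mul' := fun g h => by
        apply Subtype.ext
        ext v
        simp }
  have hτ : ∀ g v, τ g • v = ρ g v := fun g v => rfl
  let φ : (m : MaximalSpectrum R) → G →* (R ⧸ m.asIdeal)ˣ := fun m =>
    MonoidHom.toHomUnits ((Ideal.Quotient.mk m.asIdeal : R →* R ⧸ m.asIdeal).comp τ)
  let T : MaximalSpectrum R → Subgroup G := fun m => (CommGroup.torsion _).comap (φ m)
  have hT : ∀ m g, g ∈ T m ↔ ∃ n : ℕ, 0 < n ∧ τ (g ^ n) - 1 ∈ m.asIdeal := by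
    intro m g
    have : g ∈ T m ↔ IsOfFinOrder (φ m g) := Iff.rfl
    rw [this, isOfFinOrder_iff_pow_eq_one]
    refine exists_congr fun n => and_congr_right fun _ => ?_
    rw [← map_pow, ← Ideal.Quotient.eq, Units.ext_iff]
    rfl
  -- each `T m` is proper
  have hTne : ∀ m, T m ≠ ⊤ := by
    intro m hm
    have hmin : m.asIdeal ∈ (Module.annihilator R V).minimalPrimes := by
      have hann : Module.annihilator R V ≤ m.asIdeal := by
        intro x hx
        rw [Module.mem_annihilator] at hx
        have : x = 0 := by
          apply Subtype.ext
          ext v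
          exact hx v
        rw [this]
        exact zero_mem _
      have := m.isMaximal.isPrime
      obtain ⟨p, hp, hpm⟩ := Ideal.exists_minimalPrimes_le hann
      have := hp.1.1
      have hpmax : p.IsMaximal := IsArtinianRing.isMaximal_of_isPrime p
      rwa [← hpmax.eq_of_le m.isMaximal.ne_top hpm]
    have hass := Module.associatedPrimes.minimalPrimes_annihilator_subset_associatedPrimes R V hmin
    obtain ⟨hp, v, hv⟩ := isAssociatedPrime_iff.mp hass
    have hmv : ∀ x : R, x ∈ m.asIdeal ↔ x • v = 0 := by
      intro x
      rw [hv, Submodule.mem_colon_singleton, Submodule.mem_bot]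
    have hv0 : v ≠ 0 := by
      rintro rfl
      exact m.isMaximal.ne_top ((Ideal.eq_top_iff_one _).mpr ((hmv 1).mpr (smul_zero _)))
    let S : Subgroup G :=
      { carrier := {g | ρ g v = v}
        one_mem' := by simp
        mul_mem' := fun {a b} ha hb => by
          change ρ (a * b) v = v
          rw [map_mul, LinearEquiv.mul_apply, show ρ b v = v from hb, show ρ a v = v from ha]
        inv_mem' := fun {a} ha => by
          change ρ a⁻¹ v = v
          conv_lhs => rw [← show ρ a v = v from ha]
          rw [← LinearEquiv.mul_apply, ← map_mul, inv_mul_cancel, map_one]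
          rfl }
    have hSmem : ∀ g, g ∈ S ↔ ρ g v = v := fun g => Iff.rfl
    have htor : IsMulTorsion (G ⧸ S) := by
      intro q
      obtain ⟨g, rfl⟩ := QuotientGroup.mk_surjective q
      obtain ⟨n, hn, hmem⟩ := (hT m g).mp (hm ▸ Subgroup.mem_top g)
      rw [isOfFinOrder_iff_pow_eq_one]
      refine ⟨n, hn, ?_⟩
      rw [← QuotientGroup.mk_pow, QuotientGroup.eq_one_iff, hSmem, ← hτ]
      have h1 := (hmv _).mp hmem
      rwa [sub_smul, one_smul, sub_eq_zero] at h1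
    have hfin : Finite (G ⧸ S) := CommGroup.finite_of_fg_isMulTorsion _ htor
    refine hinf v hv0 ?_
    have hsub : (Set.range fun g => ρ g v) ⊆
        Set.range fun q : G ⧸ S => ρ q.out v := by
      rintro _ ⟨g, rfl⟩
      refine ⟨(g : G ⧸ S), ?_⟩
      have h1 : g⁻¹ * (g : G ⧸ S).out ∈ S := by
        rw [← QuotientGroup.eq]
        simp
      have h2 := (hSmem _).mp h1
      have h3 : (g : G ⧸ S).out = g * (g⁻¹ * (g : G ⧸ S).out) := by group
      change ρ ((g : G ⧸ S).out) v = ρ g v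
      rw [h3, map_mul, LinearEquiv.mul_apply, h2]
    exact (Set.finite_range _).subset hsub
  by_contra! hbad
  have hcov : ⋃ m ∈ (Set.toFinite (Set.univ : Set (MaximalSpectrum R))).toFinset,
      (1 : G) • (T m : Set G) = Set.univ := by
    rw [Set.eq_univ_iff_forall]
    intro g
    obtain ⟨v, hv, n, hn, hgv⟩ := hbad g
    have hnu : ¬ IsUnit (τ (g ^ n) - 1) := by
      intro hu
      apply hv
      rw [← hu.smul_eq_zero, sub_smul, hτ, hgv, one_smul, sub_self]
    obtain ⟨m, hm, hmem⟩ := exists_max_ideal_of_mem_nonunits hnu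
    simp only [Set.mem_iUnion]
    refine ⟨⟨m, hm⟩, by simp, ?_⟩
    rw [one_smul]
    exact (hT _ g).mpr ⟨n, hn, hmem⟩
  obtain ⟨m, -, hfi⟩ := Subgroup.exists_finiteIndex_of_leftCoset_cover hcov
  apply hTne m
  rw [eq_top_iff]
  intro g _
  have h1 : g ^ (T m).index ∈ T m := Subgroup.pow_index_mem (T m) g
  obtain ⟨n, hn, hmem⟩ := (hT m _).mp h1
  refine (hT m g).mpr ⟨(T m).index * n, Nat.mul_pos (Nat.pos_of_ne_zero hfi.index_ne_zero) hn, ?_⟩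
  rwa [pow_mul]

end Alg
section Fin

variable (𝔽 : Type*) [Field 𝔽] [TopologicalSpace 𝔽] [DiscreteTopology 𝔽] (r : ℕ)

/-- linear automorphisms as automorphisms of the multiplicative group -/
def linHom : ((Fin r → 𝔽) ≃ₗ[𝔽] (Fin r → 𝔽)) →* ↥(ContAut (Multiplicative (Fin r → 𝔽))) :=
  MonoidHom.mk' (linearContAut 𝔽 r) (fun _ _ => rfl)

lemma linHom_apply (e : (Fin r → 𝔽) ≃ₗ[𝔽] (Fin r → 𝔽)) (v : Multiplicative (Fin r → 𝔽)) :
    ((linHom 𝔽 r e : ↥(ContAut (Multiplicative (Fin r → 𝔽)))) : MulAut _) v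
      = Multiplicative.ofAdd (e v.toAdd) := rfl

lemma dualHom_injective {A : Type*} [CommGroup A] [TopologicalSpace A] [DiscreteTopology A] :
    Function.Injective (dualHom A) := by
  rw [injective_iff_map_eq_one]
  intro e he
  have h1 : ∀ a : A, ((e⁻¹ : ↥(ContAut A)) : MulAut A) a = a := by
    intro a
    by_contra hne
    obtain ⟨χ, hχ⟩ := exists_char_ne (((e⁻¹ : ↥(ContAut A)) : MulAut A) a * a⁻¹)
      (by rwa [Ne, mul_inv_eq_one])
    apply hχ
    have h2 : ((dualHom A e : ↥(ContAut (PontryaginDual A))) : MulAut (PontryaginDual A)) χ a = χ a := by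
      rw [he]; rfl
    rw [dualHom_apply, dualAut_apply] at h2
    rw [map_mul, h2, ← map_mul, mul_inv_cancel, map_one]
  have h2 : e⁻¹ = 1 := Subtype.ext (MulEquiv.ext h1)
  exact inv_eq_one.mp h2

lemma linHom_injective : Function.Injective (linHom 𝔽 r) := by
  rw [injective_iff_map_eq_one]
  intro e he
  ext1 v
  have := linHom_apply 𝔽 r e (Multiplicative.ofAdd v)
  rw [he] at this
  exact (Multiplicative.ofAdd.injective this).symm

lemma part_one [Countable 𝔽] :
    HasDCC {β : ↥(ContAut (PontryaginDual (Multiplicative (Fin r → 𝔽)))) |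
      ∀ e : (Fin r → 𝔽) ≃ₗ[𝔽] (Fin r → 𝔽),
        β * dualAut _ (linearContAut 𝔽 r e) = dualAut _ (linearContAut 𝔽 r e) * β} := by
  intro C hcl hdec hinv
  have hanti : Antitone C := antitone_nat_of_succ_le hdec
  let D : ℕ → Submodule 𝔽 (Fin r → 𝔽) := fun n =>
    { carrier := {v | ∀ χ ∈ C n, χ (Multiplicative.ofAdd v) = 1}
      zero_mem' := fun χ _ => map_one χ
      add_mem' := fun {v w} hv hw χ hχ => by
        rw [ofAdd_add, map_mul, hv χ hχ, hw χ hχ, one_mul]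
      smul_mem' := fun a v hv χ hχ => by
        by_cases ha : a = 0
        · subst ha
          rw [zero_smul]
          exact map_one χ
        · let e : (Fin r → 𝔽) ≃ₗ[𝔽] (Fin r → 𝔽) := (LinearEquiv.smulOfNeZero 𝔽 _ a ha).symm
          have hmem : dualAut _ (linearContAut 𝔽 r e) ∈
              {β : ↥(ContAut (PontryaginDual (Multiplicative (Fin r → 𝔽)))) |
                ∀ e : (Fin r → 𝔽) ≃ₗ[𝔽] (Fin r → 𝔽),
                β * dualAut _ (linearContAut 𝔽 r e) = dualAut _ (linearContAut 𝔽 r e) * β} := by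
            intro f
            have hc : e * f = f * e := by
              have h' : (LinearEquiv.smulOfNeZero 𝔽 (Fin r → 𝔽) a ha) * f
                  = f * (LinearEquiv.smulOfNeZero 𝔽 (Fin r → 𝔽) a ha) := by
                ext1 w
                exact (map_smul f a w).symm
              exact ((Commute.inv_left (G := (Fin r → 𝔽) ≃ₗ[𝔽] (Fin r → 𝔽)) h') :)
            have := congrArg (fun x => dualHom _ (linHom 𝔽 r x)) hc
            simp only [map_mul] at this
            exact this
          have h1 := (hinv n _ hmem χ).mp hχ
          exact hv _ h1 }
  have hD : ∀ n v, v ∈ D n ↔ ∀ χ ∈ C n, χ (Multiplicative.ofAdd v) = 1 := fun n v => Iff.rfl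
  have hmono : Monotone D := fun i j hij v hv χ hχ => hv χ (hanti hij hχ)
  obtain ⟨N, hN⟩ := monotone_stabilizes_iff_noetherian.mpr
    (inferInstance : IsNoetherian 𝔽 (Fin r → 𝔽)) ⟨D, hmono⟩
  refine ⟨N, fun n hn => le_antisymm (hanti hn) fun χ hχ => ?_⟩
  have : Countable (Multiplicative (Fin r → 𝔽)) := inferInstanceAs (Countable (Fin r → 𝔽))
  refine mem_of_annihilator (C n) (hcl n) χ fun a ha => ?_
  have h1 : a.toAdd ∈ D n := ha
  have h2 : D N = D n := hN n hn
  rw [← h2] at h1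
  exact h1 χ hχ

end Fin

/-- Theorem 5.1. Let `𝔽` be a countable discrete field, `r ≥ 1`, and
`K_r` the Pontryagin dual of `𝔽^r`. Then (1) the centraliser of `Aut_𝔽(K_r)` (the duals
of `𝔽`-linear automorphisms of `𝔽^r`) in the group of continuous automorphisms of `K_r`
has DCC on `K_r`; and (2) every finitely generated abelian subgroup of `Aut_𝔽(K_r)` which
is ergodic on `K_r` contains an ergodic automorphism. -/
theorem statement17 (𝔽 : Type*) [Field 𝔽] [Countable 𝔽]
    [TopologicalSpace 𝔽] [DiscreteTopology 𝔽] (r : ℕ) (hr : 1 ≤ r)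
    [MeasurableSpace (PontryaginDual (Multiplicative (Fin r → 𝔽)))]
    [BorelSpace (PontryaginDual (Multiplicative (Fin r → 𝔽)))]
    (μ : Measure (PontryaginDual (Multiplicative (Fin r → 𝔽))))
    [μ.IsHaarMeasure] [IsProbabilityMeasure μ] :
    HasDCC {β : ↥(ContAut (PontryaginDual (Multiplicative (Fin r → 𝔽)))) |
      ∀ e : (Fin r → 𝔽) ≃ₗ[𝔽] (Fin r → 𝔽),
        β * dualAut _ (linearContAut 𝔽 r e) = dualAut _ (linearContAut 𝔽 r e) * β}
    ∧ ∀ {m : ℕ} (g : Fin m → ((Fin r → 𝔽) ≃ₗ[𝔽] (Fin r → 𝔽))),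
        (∀ i j, dualAut _ (linearContAut 𝔽 r (g i)) * dualAut _ (linearContAut 𝔽 r (g j))
          = dualAut _ (linearContAut 𝔽 r (g j)) * dualAut _ (linearContAut 𝔽 r (g i))) →
        ∀ Γ : Subgroup ↥(ContAut (PontryaginDual (Multiplicative (Fin r → 𝔽)))),
          Γ = Subgroup.closure (Set.range fun i => dualAut _ (linearContAut 𝔽 r (g i))) →
          ErgSet μ (Γ : Set ↥(ContAut (PontryaginDual (Multiplicative (Fin r → 𝔽))))) →
          ∃ a ∈ Γ, ErgAut μ a := by
  refine ⟨part_one 𝔽 r, ?_⟩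
  intro m g hcomm Γ hΓ hE
  have hg : ∀ x ∈ Set.range g, ∀ y ∈ Set.range g, x * y = y * x := by
    rintro _ ⟨i, rfl⟩ _ ⟨j, rfl⟩
    apply linHom_injective 𝔽 r
    apply dualHom_injective
    simp only [map_mul]
    exact hcomm i j
  set H : Subgroup ((Fin r → 𝔽) ≃ₗ[𝔽] (Fin r → 𝔽)) := Subgroup.closure (Set.range g) with hH
  have hHc : IsMulCommutative H := Subgroup.isMulCommutative_closure hg
  have hFG : Group.FG H := Group.closure_finite_fg _
  have hΓH : Γ = (H.map (linHom 𝔽 r)).map (dualHom _) := by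
    rw [hΓ, hH, MonoidHom.map_closure, MonoidHom.map_closure, ← Set.range_comp, ← Set.range_comp]
    rfl
  have hE' : ErgSet μ (dualAut _ '' ((H.map (linHom 𝔽 r) : Subgroup _) : Set _)) := by
    rw [hΓH] at hE
    exact hE
  have horb := orbit_infinite μ (H.map (linHom 𝔽 r)) hE'
  let _ : CommGroup H := { (inferInstance : Group H) with mul_comm := fun a b => hHc.is_comm.comm a b }
  obtain ⟨γ, hγ⟩ := exists_good (F := 𝔽) (V := Fin r → 𝔽) (G := H) H.subtype (by
    intro v hv hfin
    apply horb (Multiplicative.ofAdd v) hv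
    refine (hfin.image Multiplicative.ofAdd).subset ?_
    rintro _ ⟨_, ⟨h, hh, rfl⟩, rfl⟩
    exact ⟨_, ⟨⟨h, hh⟩, rfl⟩, rfl⟩)
  refine ⟨dualHom _ (linHom 𝔽 r γ), ?_, ?_⟩
  · rw [hΓH]
    exact ⟨_, ⟨_, γ.2, rfl⟩, rfl⟩
  · have : Countable (Multiplicative (Fin r → 𝔽)) := inferInstanceAs (Countable (Fin r → 𝔽))
    apply ergAut_of_infinite
    intro v hv
    have key : ∀ i j : ℤ, i < j → ((γ ^ i : H) : (Fin r → 𝔽) ≃ₗ[𝔽] (Fin r → 𝔽)) v.toAdd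
        ≠ ((γ ^ j : H) : (Fin r → 𝔽) ≃ₗ[𝔽] (Fin r → 𝔽)) v.toAdd := by
      intro i j hij heq
      obtain ⟨n, hn⟩ := Int.eq_ofNat_of_zero_le (show 0 ≤ j - i by omega)
      refine hγ v.toAdd hv n (by omega) ?_
      have h1 : γ ^ j = γ ^ i * γ ^ n := by
        rw [← zpow_natCast, ← zpow_add, ← hn]
        congr 1
        omega
      rw [h1, Subgroup.coe_mul, LinearEquiv.mul_apply] at heq
      exact (LinearEquiv.injective _ heq).symm
    refine Set.infinite_range_of_injective fun i j hij => ?_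
    have hij' : ((γ ^ i : H) : (Fin r → 𝔽) ≃ₗ[𝔽] (Fin r → 𝔽)) v.toAdd
        = ((γ ^ j : H) : (Fin r → 𝔽) ≃ₗ[𝔽] (Fin r → 𝔽)) v.toAdd := by
      simp only [← map_zpow, linHom_apply] at hij
      exact Multiplicative.ofAdd.injective hij
    rcases lt_trichotomy i j with h | h | h
    · exact absurd hij' (key i j h)
    · exact h
    · exact absurd hij'.symm (key j i h)

end ErgZd
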